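/- Puiseux's theorem (real-analytic version): let a_1, …, a_n : I → ℂ be real-analytic functions on an open interval I ∋ 0 in ℝ. Then there exist a positive integer γ, an open interval J ∋ 0, and real-analytic functions λ_1, …, λ_n : J → ℂ such that for every t ∈ J the identity z^n + ∑_{j=1}^n (−1)^j a_j(t^γ) z^{n−j} = ∏_{j=1}^n (z − λ_j(t)) holds in ℂ[z]. -/

import Mathlib

open Polynomial

/-- The monic polynomial `z^n + ∑_{j=1}^n (-1)^j a_j z^{n-j}`, where `a j` (for `j : Fin n`)
corresponds to the coefficient `a_{j+1}`. -/
noncomputable def monicPoly (n : ℕ) (a : Fin n → ℂ) : Polynomial ℂ :=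
  X ^ n + ∑ j : Fin n, C ((-1 : ℂ) ^ ((j : ℕ) + 1) * a j) * X ^ (n - ((j : ℕ) + 1))

open Filter Topology

/-- Polynomial of degree `< k` with given coefficients. -/
noncomputable def lowPoly (k : ℕ) : (Fin k → ℂ) →ₗ[ℂ] ℂ[X] where
  toFun u := ∑ i, C (u i) * X ^ (i : ℕ)
  map_add' u v := by simp [add_mul, Finset.sum_add_distrib]
  map_smul' c u := by simp [Finset.mul_sum, smul_eq_C_mul, mul_assoc]

lemma lowPoly_apply (k : ℕ) (u : Fin k → ℂ) : lowPoly k u = ∑ i, C (u i) * X ^ (i : ℕ) := rfl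

lemma lowPoly_degree (k : ℕ) (u : Fin k → ℂ) : (lowPoly k u).degree < k := by
  rw [lowPoly_apply]
  refine (degree_sum_le _ _).trans_lt ?_
  rw [Finset.sup_lt_iff (WithBot.bot_lt_coe _)]
  intro i _
  refine (degree_C_mul_X_pow_le _ _).trans_lt ?_
  exact_mod_cast i.2

lemma lowPoly_coeff (k : ℕ) (u : Fin k → ℂ) (i : Fin k) : (lowPoly k u).coeff i = u i := by
  rw [lowPoly_apply]
  simp [coeff_X_pow, Fin.val_inj]

lemma lowPoly_coeff_of_le (k : ℕ) (u : Fin k → ℂ) (i : ℕ) (h : k ≤ i) :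
    (lowPoly k u).coeff i = 0 :=
  coeff_eq_zero_of_degree_lt ((lowPoly_degree k u).trans_le (by exact_mod_cast h))

lemma lowPoly_eq_zero (k : ℕ) (u : Fin k → ℂ) (h : lowPoly k u = 0) : u = 0 := by
  ext i
  rw [← lowPoly_coeff k u i, h]; simp

/-- The first `n` coefficients. -/
noncomputable def lowCoeff (n : ℕ) : ℂ[X] →ₗ[ℂ] (Fin n → ℂ) :=
  LinearMap.pi fun i => lcoeff ℂ (i : ℕ)

lemma lowCoeff_apply (n : ℕ) (p : ℂ[X]) (i : Fin n) : lowCoeff n p i = p.coeff i := rfl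

lemma eq_of_lowCoeff {n : ℕ} {p q : ℂ[X]} (hp : p.degree < n) (hq : q.degree < n)
    (h : lowCoeff n p = lowCoeff n q) : p = q := by
  ext i
  by_cases hi : i < n
  · exact congrFun h ⟨i, hi⟩
  · have hi' : (n : WithBot ℕ) ≤ i := by exact_mod_cast not_lt.mp hi
    rw [coeff_eq_zero_of_degree_lt (hp.trans_le hi'), coeff_eq_zero_of_degree_lt (hq.trans_le hi')]

lemma eq_of_monic_lowCoeff {n : ℕ} {p q : ℂ[X]} (hp : p.Monic) (hpn : p.natDegree = n)
    (hq : q.Monic) (hqn : q.natDegree = n)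
    (h : lowCoeff n p = lowCoeff n q) : p = q := by
  ext i
  rcases lt_trichotomy i n with hi | hi | hi
  · exact congrFun h ⟨i, hi⟩
  · have h1 := hp.coeff_natDegree
    have h2 := hq.coeff_natDegree
    rw [hpn] at h1; rw [hqn] at h2
    rw [hi, h1, h2]
  · rw [coeff_eq_zero_of_natDegree_lt (hpn ▸ hi), coeff_eq_zero_of_natDegree_lt (hqn ▸ hi)]

/-- Linearization of multiplication of monic polynomials. -/
noncomputable def mulLin (k m : ℕ) (p q : ℂ[X]) :
    ((Fin k → ℂ) × (Fin m → ℂ)) →ₗ[ℂ] (Fin (k + m) → ℂ) :=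
  (lowCoeff (k + m)) ∘ₗ
    ((LinearMap.mulLeft ℂ q ∘ₗ lowPoly k) ∘ₗ LinearMap.fst ℂ _ _ +
     (LinearMap.mulLeft ℂ p ∘ₗ lowPoly m) ∘ₗ LinearMap.snd ℂ _ _)

lemma mulLin_apply (k m : ℕ) (p q : ℂ[X]) (w) :
    mulLin k m p q w = lowCoeff (k + m) (q * lowPoly k w.1 + p * lowPoly m w.2) := rfl

lemma degree_mul_lt_aux {k m : ℕ} {p r : ℂ[X]} (hp : p.Monic) (hpk : p.natDegree = k)
    (hr : r.degree < m) : (p * r).degree < (k + m : ℕ) := by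
  rw [degree_mul, degree_eq_natDegree hp.ne_zero, hpk]
  push_cast
  exact WithBot.add_lt_add_left (by simp) hr

lemma mulLin_injective {k m : ℕ} {p q : ℂ[X]} (hp : p.Monic) (hpk : p.natDegree = k)
    (hq : q.Monic) (hqm : q.natDegree = m) (hc : IsCoprime p q) :
    Function.Injective (mulLin k m p q) := by
  rw [injective_iff_map_eq_zero]
  rintro ⟨u, v⟩ h
  rw [mulLin_apply] at h
  have h0 : q * lowPoly k u + p * lowPoly m v = 0 := by
    refine eq_of_lowCoeff (n := k + m) ?_ (by simp) (by rw [h, map_zero])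
    refine (degree_add_le _ _).trans_lt (max_lt ?_ ?_)
    · rw [add_comm k m]; exact degree_mul_lt_aux hq hqm (lowPoly_degree _ _)
    · exact degree_mul_lt_aux hp hpk (lowPoly_degree _ _)
  have hu : lowPoly k u = 0 := by
    refine eq_zero_of_dvd_of_degree_lt (p := p) ?_ ?_
    · refine hc.dvd_of_dvd_mul_left (z := lowPoly k u) (y := q) ?_
      exact (dvd_add_left (dvd_mul_right p _)).mp (h0 ▸ dvd_zero p)
    · rw [degree_eq_natDegree hp.ne_zero, hpk]; exact lowPoly_degree _ _
  have hv : lowPoly m v = 0 := by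
    rw [hu, mul_zero, zero_add] at h0
    exact (mul_eq_zero.mp h0).resolve_left hp.ne_zero
  rw [lowPoly_eq_zero _ _ hu, lowPoly_eq_zero _ _ hv]; rfl

/-- bilinear part -/
noncomputable def mulBil (k m : ℕ) :
    (Fin k → ℂ) →ₗ[ℂ] (Fin m → ℂ) →ₗ[ℂ] (Fin (k + m) → ℂ) :=
  ((LinearMap.mul ℂ ℂ[X]).compl₁₂ (lowPoly k) (lowPoly m)).compr₂ (lowCoeff (k + m))

lemma mulBil_apply (k m : ℕ) (u v) :
   mulBil k m u v = lowCoeff (k + m) (lowPoly k u * lowPoly m v) := rfl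

lemma monic_add_lowPoly {k : ℕ} {p : ℂ[X]} (hp : p.Monic) (hpk : p.natDegree = k) (u) :
    (p + lowPoly k u).Monic ∧ (p + lowPoly k u).natDegree = k := by
  have h : (lowPoly k u).degree < p.degree := by
    rw [degree_eq_natDegree hp.ne_zero, hpk]; exact lowPoly_degree _ _
  exact ⟨hp.add_of_left h, by rw [natDegree_add_eq_left_of_degree_lt h, hpk]⟩

/-- local inversion of multiplication of polynomials -/
lemma exists_local_factor {k m : ℕ} {p q : ℂ[X]} (hp : p.Monic) (hpk : p.natDegree = k)
    (hq : q.Monic) (hqm : q.natDegree = m) (hc : IsCoprime p q) :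
    ∃ g : (Fin (k + m) → ℂ) → (Fin k → ℂ) × (Fin m → ℂ),
      AnalyticAt ℝ g (lowCoeff (k + m) (p * q)) ∧
      ∀ᶠ y in 𝓝 (lowCoeff (k + m) (p * q)),
        lowCoeff (k + m) ((p + lowPoly k (g y).1) * (q + lowPoly m (g y).2)) = y := by
  let A := (mulLin k m p q).linearEquivOfInjective (mulLin_injective hp hpk hq hqm hc) (by simp)
  let Ae := A.toContinuousLinearEquiv
  let B := (mulBil k m).toContinuousBilinearMap
  let Φ : (Fin k → ℂ) × (Fin m → ℂ) → (Fin (k + m) → ℂ) := fun w =>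
    lowCoeff (k + m) (p * q) + (Ae w + B w.1 w.2)
  have hΦ : ∀ w, Φ w = lowCoeff (k + m) ((p + lowPoly k w.1) * (q + lowPoly m w.2)) := by
    intro w
    have h1 : Ae w = mulLin k m p q w := rfl
    have h2 : B w.1 w.2 = mulBil k m w.1 w.2 := rfl
    simp only [Φ, h1, h2, mulLin_apply, mulBil_apply]
    rw [← map_add, ← map_add]
    congr 1; ring
  have hΦ0 : Φ 0 = lowCoeff (k + m) (p * q) := by simp [hΦ]
  have hcd : ContDiffAt ℂ ⊤ Φ 0 := by
    refine contDiffAt_const.add (Ae.contDiff.contDiffAt.add ?_)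
    exact B.isBoundedBilinearMap.contDiff.contDiffAt
  have hd : HasFDerivAt Φ (Ae : ((Fin k → ℂ) × (Fin m → ℂ)) →L[ℂ] (Fin (k + m) → ℂ)) 0 := by
    have hb := B.isBoundedBilinearMap.hasFDerivAt (0 : (Fin k → ℂ) × (Fin m → ℂ))
    have := (Ae.hasFDerivAt.add hb).const_add (lowCoeff (k + m) (p * q))
    have hz : B.isBoundedBilinearMap.deriv (0 : (Fin k → ℂ) × (Fin m → ℂ)) = 0 := by
      ext w <;> simp
    rw [hz, add_zero] at this
    exact this
  have hs := hcd.hasStrictFDerivAt' hd (by simp)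
  have hn : (⊤ : WithTop ℕ∞) ≠ 0 := by simp
  refine ⟨hcd.localInverse hd hn, ?_, ?_⟩
  · have := (hcd.to_localInverse hd hn).analyticAt
    rw [hΦ0] at this
    exact this.restrictScalars
  · have := hs.eventually_right_inverse
    rw [hΦ0] at this
    filter_upwards [this] with y hy
    rw [← hΦ]; exact hy

/-- analytic Hensel -/
lemma hensel_factor {k m : ℕ} {p q : ℂ[X]} (hp : p.Monic) (hpk : p.natDegree = k)
    (hq : q.Monic) (hqm : q.natDegree = m) (hc : IsCoprime p q)
    (P : ℝ → ℂ[X]) (hP : ∀ t, (P t).Monic ∧ (P t).natDegree = k + m)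
    (hA : ∀ i, AnalyticAt ℝ (fun t => (P t).coeff i) 0) (h0 : P 0 = p * q) :
    ∃ P₁ P₂ : ℝ → ℂ[X], (∀ t, (P₁ t).Monic ∧ (P₁ t).natDegree = k) ∧
      (∀ t, (P₂ t).Monic ∧ (P₂ t).natDegree = m) ∧
      (∀ i, AnalyticAt ℝ (fun t => (P₁ t).coeff i) 0) ∧
      (∀ i, AnalyticAt ℝ (fun t => (P₂ t).coeff i) 0) ∧
      ∀ᶠ t in 𝓝 0, P t = P₁ t * P₂ t := by
  obtain ⟨g, hg, hge⟩ := exists_local_factor hp hpk hq hqm hc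
  have hy : AnalyticAt ℝ (fun t => lowCoeff (k + m) (P t)) 0 := by
    rw [analyticAt_pi_iff]
    intro i; exact hA i
  rw [← h0] at hg hge
  have hgy : AnalyticAt ℝ (fun t => g (lowCoeff (k + m) (P t))) 0 :=
    AnalyticAt.fun_comp (f := fun t => lowCoeff (k + m) (P t)) hg hy
  have hco : ∀ (l : ℕ) (r : ℂ[X]) (f : ℝ → Fin l → ℂ), AnalyticAt ℝ f 0 → ∀ i,
      AnalyticAt ℝ (fun t => (r + lowPoly l (f t)).coeff i) 0 := by
    intro l r f hf i
    simp only [coeff_add]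
    refine analyticAt_const.add ?_
    by_cases hi : i < l
    · have : (fun t => (lowPoly l (f t)).coeff i) = fun t => f t ⟨i, hi⟩ := by
        ext t; exact lowPoly_coeff l (f t) ⟨i, hi⟩
      rw [this]
      exact analyticAt_pi_iff.mp hf ⟨i, hi⟩
    · simp only [lowPoly_coeff_of_le _ _ _ (not_lt.mp hi)]
      exact analyticAt_const
  refine ⟨fun t => p + lowPoly k (g (lowCoeff (k + m) (P t))).1,
    fun t => q + lowPoly m (g (lowCoeff (k + m) (P t))).2,
    fun t => monic_add_lowPoly hp hpk _, fun t => monic_add_lowPoly hq hqm _,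
    hco _ _ _ (analyticAt_fst.fun_comp hgy), hco _ _ _ (analyticAt_snd.fun_comp hgy), ?_⟩
  have := hy.continuousAt.eventually hge
  filter_upwards [this] with t ht
  have m1 := monic_add_lowPoly hp hpk (g (lowCoeff (k + m) (P t))).1
  have m2 := monic_add_lowPoly hq hqm (g (lowCoeff (k + m) (P t))).2
  refine eq_of_monic_lowCoeff (hP t).1 (hP t).2 (m1.1.mul m2.1) ?_ ht.symm
  rw [m1.1.natDegree_mul m2.1, m1.2, m2.2]

/-- The family has analytic roots after a ramified base change. -/
def Good (P : ℝ → ℂ[X]) : Prop :=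
  ∃ γ : ℕ, 0 < γ ∧ ∃ L : List (ℝ → ℂ), (∀ f ∈ L, AnalyticAt ℝ f 0) ∧
    ∀ᶠ t in 𝓝 (0 : ℝ), P (t ^ γ) = (L.map fun f => X - C (f t)).prod

lemma tendsto_pow_zero {γ : ℕ} (h : 0 < γ) : Tendsto (fun t : ℝ => t ^ γ) (𝓝 0) (𝓝 0) := by
  have : ContinuousAt (fun t : ℝ => t ^ γ) 0 := by fun_prop
  simpa [ContinuousAt, h.ne'] using this

lemma analyticAt_comp_pow {γ : ℕ} (h : 0 < γ) {f : ℝ → ℂ} (hf : AnalyticAt ℝ f 0) :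
    AnalyticAt ℝ (fun t => f (t ^ γ)) 0 := by
  have h1 : AnalyticAt ℝ (fun t : ℝ => t ^ γ) 0 := analyticAt_id.pow γ
  refine AnalyticAt.fun_comp (g := f) (f := fun t : ℝ => t ^ γ) ?_ h1
  simpa [h.ne'] using hf

lemma Good.congr {P Q : ℝ → ℂ[X]} (h : ∀ᶠ t in 𝓝 (0 : ℝ), P t = Q t) (hQ : Good Q) : Good P := by
  obtain ⟨γ, hγ, L, hL, he⟩ := hQ
  refine ⟨γ, hγ, L, hL, ?_⟩
  filter_upwards [he, (tendsto_pow_zero hγ).eventually h] with t h1 h2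
  rw [h2, h1]

lemma Good.of_pow {P : ℝ → ℂ[X]} {d : ℕ} (hd : 0 < d) (h : Good fun t => P (t ^ d)) : Good P := by
  obtain ⟨γ, hγ, L, hL, he⟩ := h
  refine ⟨γ * d, Nat.mul_pos hγ hd, L, hL, ?_⟩
  filter_upwards [he] with t h1
  rw [← h1, pow_mul]

lemma Good.mul {P Q : ℝ → ℂ[X]} (hP : Good P) (hQ : Good Q) : Good fun t => P t * Q t := by
  obtain ⟨γ, hγ, L, hL, he⟩ := hP
  obtain ⟨δ, hδ, M, hM, hf⟩ := hQ
  refine ⟨γ * δ, Nat.mul_pos hγ hδ,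
    L.map (fun f t => f (t ^ δ)) ++ M.map (fun f t => f (t ^ γ)), ?_, ?_⟩
  · intro f hf
    rcases List.mem_append.mp hf with h | h
    · obtain ⟨g, hg, rfl⟩ := List.mem_map.mp h
      exact analyticAt_comp_pow hδ (hL g hg)
    · obtain ⟨g, hg, rfl⟩ := List.mem_map.mp h
      exact analyticAt_comp_pow hγ (hM g hg)
  · filter_upwards [(tendsto_pow_zero hδ).eventually he, (tendsto_pow_zero hγ).eventually hf]
      with t h1 h2
    rw [List.map_append, List.prod_append, List.map_map, List.map_map]
    have e1 : t ^ (γ * δ) = (t ^ δ) ^ γ := by rw [← pow_mul, mul_comm]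
    have e2 : t ^ (γ * δ) = (t ^ γ) ^ δ := by rw [← pow_mul]
    rw [e1, h1, ← e1, e2, h2]
    rfl

lemma Good.translate {P : ℝ → ℂ[X]} {c : ℝ → ℂ} (hc : AnalyticAt ℝ c 0)
    (h : Good fun t => taylor (c t) (P t)) : Good P := by
  obtain ⟨γ, hγ, L, hL, he⟩ := h
  refine ⟨γ, hγ, L.map (fun f t => f t + c (t ^ γ)), ?_, ?_⟩
  · intro f hf
    obtain ⟨g, hg, rfl⟩ := List.mem_map.mp hf
    exact (hL g hg).fun_add (analyticAt_comp_pow hγ hc)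
  · filter_upwards [he] with t h1
    have h2 := congrArg (fun p => p.comp (X - C (c (t ^ γ)))) h1
    simp only [taylor_apply, comp_assoc] at h2
    rw [show (X + C (c (t ^ γ)) : ℂ[X]).comp (X - C (c (t ^ γ))) = X by simp, comp_X] at h2
    rw [h2, List.map_map]
    clear h1 h2 he hL
    induction L with
    | nil => simp
    | cons f L ih =>
      simp only [List.map_cons, List.prod_cons, mul_comp, ih]
      congr 1
      simp; ring

lemma Good.scale {Q : ℝ → ℂ[X]} (o : ℕ) (h : Good Q) :
    Good fun t => (Q t).scaleRoots ((t : ℂ) ^ o) := by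
  obtain ⟨γ, hγ, L, hL, he⟩ := h
  refine ⟨γ, hγ, L.map (fun f t => ((t ^ γ : ℝ) : ℂ) ^ o * f t), ?_, ?_⟩
  · intro f hf
    obtain ⟨g, hg, rfl⟩ := List.mem_map.mp hf
    refine AnalyticAt.fun_mul ?_ (hL g hg)
    have h1 : AnalyticAt ℝ (fun t : ℝ => (t : ℂ)) 0 := Complex.ofRealCLM.analyticAt 0
    simp only [Complex.ofReal_pow]
    exact (h1.fun_pow γ).fun_pow o
  · filter_upwards [he] with t h1
    rw [h1, List.map_map]
    clear h1 he hL
    induction L with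
    | nil => simp
    | cons f L ih =>
      simp only [List.map_cons, List.prod_cons, mul_scaleRoots_of_noZeroDivisors, ih]
      congr 1
      rw [X_sub_C_scaleRoots, mul_comm]; rfl

lemma taylor_coeff_sum {p : ℂ[X]} {n : ℕ} (hp : p.natDegree = n) (c : ℂ) (i N : ℕ)
    (hN : n - i < N) :
    (taylor c p).coeff i = ∑ j ∈ Finset.range N, ((j + i).choose i * p.coeff (j + i)) * c ^ j := by
  rw [taylor_coeff, eval_eq_sum_range' (n := N)]
  · simp [hasseDeriv_coeff]
  · refine (natDegree_hasseDeriv_le p i).trans_lt ?_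
    rw [hp]; exact hN

lemma order_aux {f : ℝ → ℂ} (hf : AnalyticAt ℝ f 0) (h : ¬ ∀ᶠ t in 𝓝 0, f t = 0) :
    ∃ (o : ℕ) (g : ℝ → ℂ), AnalyticAt ℝ g 0 ∧ g 0 ≠ 0 ∧ ∀ᶠ t in 𝓝 0, f t = (t : ℂ) ^ o * g t := by
  obtain ⟨o, g, hg, hg0, he⟩ := (hf.exists_eventuallyEq_pow_smul_nonzero_iff).mpr h
  refine ⟨o, g, hg, hg0, ?_⟩
  filter_upwards [he] with t ht
  rw [ht]; simp

/-- The Newton polygon reduction. -/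
lemma newton_step {n : ℕ} (P : ℝ → ℂ[X]) (hP : ∀ t, (P t).Monic ∧ (P t).natDegree = n)
    (hA : ∀ i, AnalyticAt ℝ (fun t => (P t).coeff i) 0)
    (hne : ∃ i < n, ¬ ∀ᶠ t in 𝓝 0, (P t).coeff i = 0) :
    ∃ (d o : ℕ) (Q : ℝ → ℂ[X]), 0 < d ∧ (∀ t, (Q t).Monic ∧ (Q t).natDegree = n) ∧
      (∀ i, AnalyticAt ℝ (fun t => (Q t).coeff i) 0) ∧
      (∀ᶠ t in 𝓝 0, P (t ^ d) = (Q t).scaleRoots ((t : ℂ) ^ o)) ∧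
      (∃ i < n, (Q 0).coeff i ≠ 0) ∧
      (∀ i < n, (∀ᶠ t in 𝓝 0, (P t).coeff i = 0) → (Q 0).coeff i = 0) := by
  classical
  let Z : ℕ → Prop := fun i => ∀ᶠ t in 𝓝 0, (P t).coeff i = 0
  have key : ∀ i, ∃ (o : ℕ) (g : ℝ → ℂ), ¬ Z i → (AnalyticAt ℝ g 0 ∧ g 0 ≠ 0 ∧
      ∀ᶠ t in 𝓝 0, (P t).coeff i = (t : ℂ) ^ o * g t) := by
    intro i
    by_cases h : Z i
    · exact ⟨0, 0, fun hh => absurd h hh⟩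
    · obtain ⟨o, g, hh⟩ := order_aux (hA i) h
      exact ⟨o, g, fun _ => hh⟩
  choose o g hog using key
  let S := (Finset.range n).filter (fun i => ¬ Z i)
  have hS : S.Nonempty := by
    obtain ⟨i, hi, h⟩ := hne
    exact ⟨i, by simp only [S, Finset.mem_filter, Finset.mem_range]; exact ⟨hi, h⟩⟩
  obtain ⟨i₀, hi₀, hmin⟩ := S.exists_min_image (fun i => (o i : ℚ) / ((n - i : ℕ) : ℚ)) hS
  simp only [S, Finset.mem_filter, Finset.mem_range] at hi₀ hmin
  obtain ⟨hi₀n, hi₀Z⟩ := hi₀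
  have hmin' : ∀ i, i < n → ¬ Z i → o i₀ * (n - i) ≤ (n - i₀) * o i := by
    intro i hi hZ
    have h1 := hmin i ⟨hi, hZ⟩
    have p1 : (0 : ℚ) < ((n - i₀ : ℕ) : ℚ) := by exact_mod_cast Nat.sub_pos_of_lt hi₀n
    have p2 : (0 : ℚ) < ((n - i : ℕ) : ℚ) := by exact_mod_cast Nat.sub_pos_of_lt hi
    rw [div_le_div_iff₀ p1 p2] at h1
    have h2 : o i₀ * (n - i) ≤ o i * (n - i₀) := by exact_mod_cast h1
    rw [mul_comm (n - i₀)]; exact h2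
  have hd : 0 < n - i₀ := Nat.sub_pos_of_lt hi₀n
  let b : ℕ → ℝ → ℂ := fun i t =>
    if Z i then 0 else (t : ℂ) ^ ((n - i₀) * o i - o i₀ * (n - i)) * g i (t ^ (n - i₀))
  have hb : ∀ i, AnalyticAt ℝ (b i) 0 := by
    intro i
    by_cases hZ : Z i
    · simp only [b, hZ, if_true]; exact analyticAt_const
    · simp only [b, hZ, if_false]
      have h1 : AnalyticAt ℝ (fun t : ℝ => (t : ℂ)) 0 := Complex.ofRealCLM.analyticAt 0
      exact (h1.fun_pow _).fun_mul (analyticAt_comp_pow hd (hog i hZ).1)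
  let Q : ℝ → ℂ[X] := fun t => X ^ n + lowPoly n (fun i => b i t)
  have hQ : ∀ t, (Q t).Monic ∧ (Q t).natDegree = n := fun t =>
    monic_add_lowPoly (monic_X_pow n) (natDegree_X_pow n) _
  have hQc : ∀ t, ∀ i < n, (Q t).coeff i = b i t := by
    intro t i hi
    simp only [Q, coeff_add, coeff_X_pow, hi.ne, if_false, zero_add]
    exact lowPoly_coeff n _ ⟨i, hi⟩
  refine ⟨n - i₀, o i₀, Q, hd, hQ, ?_, ?_, ⟨i₀, hi₀n, ?_⟩, ?_⟩
  · intro i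
    by_cases hi : i < n
    · simp only [hQc _ i hi]; exact hb i
    · simp only [Q, coeff_add, lowPoly_coeff_of_le _ _ _ (not_lt.mp hi)]
      exact analyticAt_const
  · have hall : ∀ᶠ t : ℝ in 𝓝 0, ∀ i ∈ Finset.range n,
        (P (t ^ (n - i₀))).coeff i = b i t * ((t : ℂ) ^ o i₀) ^ (n - i) := by
      rw [Filter.eventually_all_finset]
      intro i hi
      have hi := Finset.mem_range.mp hi
      by_cases hZ : Z i
      · filter_upwards [(tendsto_pow_zero hd).eventually hZ] with t ht
        simp [b, hZ, ht]
      · filter_upwards [(tendsto_pow_zero hd).eventually (hog i hZ).2.2] with t ht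
        simp only [b, hZ, if_false, ht]
        have h3 := Nat.sub_add_cancel (hmin' i hi hZ)
        rw [← pow_mul, mul_right_comm, ← pow_add, h3, Complex.ofReal_pow, ← pow_mul]
    filter_upwards [hall] with t ht
    refine eq_of_monic_lowCoeff (hP _).1 (hP _).2 ((monic_scaleRoots_iff _).mpr (hQ t).1)
      (by rw [natDegree_scaleRoots, (hQ t).2]) ?_
    ext i
    rw [lowCoeff_apply, lowCoeff_apply, coeff_scaleRoots, (hQ t).2, hQc t i i.2,
      ht i (Finset.mem_range.mpr i.2)]
  · rw [hQc 0 i₀ hi₀n]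
    simp only [b, hi₀Z, if_false]
    rw [mul_comm (o i₀), Nat.sub_self, pow_zero, one_mul, zero_pow hd.ne']
    exact (hog i₀ hi₀Z).2.1
  · intro i hi hZ
    rw [hQc 0 i hi]
    simp only [b, show Z i from hZ, if_true]

/-- A nontrivial depressed polynomial has a coprime factorization. -/
lemma split_depressed {n : ℕ} (q : ℂ[X]) (hq : q.Monic) (hqn : q.natDegree = n)
    (hi : ∃ i < n, q.coeff i ≠ 0) (hz : q.coeff (n - 1) = 0) :
    ∃ p₁ p₂ : ℂ[X], p₁.Monic ∧ p₂.Monic ∧ IsCoprime p₁ p₂ ∧ q = p₁ * p₂ ∧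
      p₁.natDegree < n ∧ p₂.natDegree < n := by
  obtain ⟨i, hin, hi⟩ := hi
  obtain ⟨r, hr⟩ := IsAlgClosed.exists_root q (by
    rw [degree_eq_natDegree hq.ne_zero, hqn]
    exact_mod_cast (show n ≠ 0 by omega))
  obtain ⟨s, hs, hnd⟩ := exists_eq_pow_rootMultiplicity_mul_and_not_dvd q hq.ne_zero r
  have hk : 0 < rootMultiplicity r q := (rootMultiplicity_pos hq.ne_zero).mpr hr
  set k := rootMultiplicity r q
  have hm : ((X - C r) ^ k).Monic := (monic_X_sub_C r).pow k
  have hsm : s.Monic := hm.of_mul_monic_left (hs ▸ hq)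
  have hdeg : n = k + s.natDegree := by
    rw [← hqn, hs, hm.natDegree_mul hsm, natDegree_pow, natDegree_X_sub_C, mul_one]
  have hspos : s.natDegree ≠ 0 := by
    intro h0
    have hs1 : s = 1 := hsm.natDegree_eq_zero.mp h0
    rw [hs1, mul_one] at hs
    have hkn : k = n := by omega
    rw [hkn] at hs
    rw [hs, sub_eq_add_neg, ← C_neg, coeff_X_add_C_pow] at hz
    have e : n - (n - 1) = 1 := by omega
    have hn0 : n.choose (n - 1) ≠ 0 := (Nat.choose_pos (by omega)).ne'
    have hr0 : r = 0 := by
      rw [e, pow_one] at hz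
      rcases mul_eq_zero.mp hz with h | h
      · simpa using h
      · exact absurd (by exact_mod_cast h) hn0
    apply hi
    rw [hs, hr0, map_zero, sub_zero, coeff_X_pow, if_neg hin.ne]
  refine ⟨(X - C r) ^ k, s, hm, hsm, ?_, hs, ?_, by omega⟩
  · exact (((irreducible_X_sub_C r).coprime_iff_not_dvd).mpr hnd).pow_left
  · rw [natDegree_pow, natDegree_X_sub_C]; omega

lemma good_of_monic (n : ℕ) : ∀ (P : ℝ → ℂ[X]), (∀ t, (P t).Monic ∧ (P t).natDegree = n) →
    (∀ i, AnalyticAt ℝ (fun t => (P t).coeff i) 0) → Good P := by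
  induction n using Nat.strong_induction_on with
  | _ n ih =>
  intro P hP hA
  let c : ℝ → ℂ := fun t => -(P t).coeff (n - 1) / n
  have hc : AnalyticAt ℝ c 0 := by
    simp only [c, div_eq_mul_inv]
    exact (hA _).fun_neg.fun_mul analyticAt_const
  refine Good.translate hc ?_
  let R : ℝ → ℂ[X] := fun t => taylor (c t) (P t)
  have hR : ∀ t, (R t).Monic ∧ (R t).natDegree = n := by
    intro t
    exact ⟨by simp [R, Monic, leadingCoeff_taylor, (hP t).1.leadingCoeff], by simp [R, natDegree_taylor, (hP t).2]⟩
  have hRA : ∀ i, AnalyticAt ℝ (fun t => (R t).coeff i) 0 := by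
    intro i
    have : (fun t => (R t).coeff i) = fun t => ∑ j ∈ Finset.range (n + 1),
        ((j + i).choose i * (P t).coeff (j + i)) * (c t) ^ j := by
      ext t; exact taylor_coeff_sum (hP t).2 _ _ _ (by omega)
    rw [this]
    exact Finset.analyticAt_fun_sum _ fun j _ =>
      (analyticAt_const.fun_mul (hA _)).fun_mul (hc.fun_pow j)
  have hRz : 0 < n → ∀ t, (R t).coeff (n - 1) = 0 := by
    intro hn t
    have h1 := taylor_coeff_sum (hP t).2 (c t) (n - 1) 2 (by omega)
    have h2 : 1 + (n - 1) = n := by omega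
    have h3 : (P t).coeff n = 1 := by
      have := (hP t).1.coeff_natDegree
      rwa [(hP t).2] at this
    have h4 : n.choose (n - 1) = n := by
      rw [Nat.choose_symm (by omega : 1 ≤ n), Nat.choose_one_right]
    have h5 : (n : ℂ) ≠ 0 := by exact_mod_cast hn.ne'
    simp only [R]
    rw [h1, Finset.sum_range_succ, Finset.sum_range_one, h2, h3, h4]
    simp only [zero_add, Nat.choose_self, Nat.cast_one, pow_zero, pow_one, one_mul, mul_one, c]
    field_simp
    ring
  change Good R
  by_cases hne : ∃ i < n, ¬ ∀ᶠ t in 𝓝 0, (R t).coeff i = 0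
  · have hn : 0 < n := by obtain ⟨i, hi, _⟩ := hne; omega
    obtain ⟨d, o, Q, hd, hQ, hQA, hQe, hQn, hQz⟩ := newton_step R hR hRA hne
    refine Good.of_pow hd (Good.congr hQe (Good.scale o ?_))
    obtain ⟨p₁, p₂, hp₁, hp₂, hcop, heq, hl₁, hl₂⟩ := split_depressed (Q 0) (hQ 0).1 (hQ 0).2 hQn
      (hQz (n - 1) (by omega) (Eventually.of_forall (hRz hn)))
    have hdeg : n = p₁.natDegree + p₂.natDegree := by
      rw [← (hQ 0).2, heq, hp₁.natDegree_mul hp₂]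
    obtain ⟨P₁, P₂, h₁, h₂, a₁, a₂, he⟩ := hensel_factor hp₁ rfl hp₂ rfl hcop Q
      (fun t => ⟨(hQ t).1, (hQ t).2.trans hdeg⟩) hQA heq
    exact Good.congr he ((ih _ hl₁ P₁ h₁ a₁).mul (ih _ hl₂ P₂ h₂ a₂))
  · push Not at hne
    refine ⟨1, one_pos, List.replicate n 0, ?_, ?_⟩
    · intro f hf
      rw [List.eq_of_mem_replicate hf]; exact analyticAt_const
    · have hall : ∀ᶠ t : ℝ in 𝓝 0, ∀ i ∈ Finset.range n, (R t).coeff i = 0 := by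
        rw [Filter.eventually_all_finset]
        intro i hi
        exact hne i (Finset.mem_range.mp hi)
      filter_upwards [hall] with t ht
      rw [pow_one]
      simp only [List.map_replicate, List.prod_replicate, Pi.zero_apply, map_zero, sub_zero]
      refine eq_of_monic_lowCoeff (hR t).1 (hR t).2 (monic_X_pow n) (natDegree_X_pow n) ?_
      ext i
      rw [lowCoeff_apply, lowCoeff_apply, ht i (Finset.mem_range.mpr i.2), coeff_X_pow,
        if_neg i.2.ne]

lemma monicPoly_monic (n : ℕ) (a : Fin n → ℂ) :
    (monicPoly n a).Monic ∧ (monicPoly n a).natDegree = n := by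
  have h : (∑ j : Fin n, C ((-1 : ℂ) ^ ((j : ℕ) + 1) * a j) * X ^ (n - ((j : ℕ) + 1))).degree
      < (X ^ n : ℂ[X]).degree := by
    rw [degree_X_pow]
    refine (degree_sum_le _ _).trans_lt ?_
    rw [Finset.sup_lt_iff (WithBot.bot_lt_coe _)]
    intro j _
    refine (degree_C_mul_X_pow_le _ _).trans_lt ?_
    have := j.2
    exact_mod_cast (by omega : n - ((j : ℕ) + 1) < n)
  exact ⟨(monic_X_pow n).add_of_left h,
    by rw [monicPoly, natDegree_add_eq_left_of_degree_lt h, natDegree_X_pow]⟩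

/-- Puiseux's theorem (real-analytic version): if the coefficients `a_j` are real analytic on
an open interval around `0`, then for some positive integer `γ` the polynomial family
`t ↦ P(t^γ)` admits a real-analytic parameterization of its roots on an open interval
`J = (-ε, ε)` around `0`. -/
theorem puiseux_real_analytic (n : ℕ) (α β : ℝ) (hα : α < 0) (hβ : 0 < β)
    (a : Fin n → ℝ → ℂ) (ha : ∀ j, AnalyticOnNhd ℝ (a j) (Set.Ioo α β)) :
    ∃ γ : ℕ, 0 < γ ∧ ∃ ε : ℝ, 0 < ε ∧ ∃ l : Fin n → ℝ → ℂ,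
      (∀ j, AnalyticOnNhd ℝ (l j) (Set.Ioo (-ε) ε)) ∧
      ∀ t ∈ Set.Ioo (-ε) ε,
        monicPoly n (fun j => a j (t ^ γ)) = ∏ j : Fin n, (X - C (l j t)) := by
  have hA : ∀ i, AnalyticAt ℝ (fun t => (monicPoly n (fun j => a j t)).coeff i) 0 := by
    intro i
    simp only [monicPoly, coeff_add, finsetSum_coeff, coeff_C_mul]
    refine analyticAt_const.fun_add (Finset.analyticAt_fun_sum _ fun j _ => ?_)
    exact (analyticAt_const.fun_mul (ha j 0 ⟨hα, hβ⟩)).fun_mul analyticAt_const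
  obtain ⟨γ, hγ, L, hL, he⟩ := good_of_monic n (fun t => monicPoly n (fun j => a j t))
    (fun t => monicPoly_monic n _) hA
  have hlen : n = L.length := by
    have h0 := congrArg natDegree he.self_of_nhds
    rw [(monicPoly_monic n _).2] at h0
    rw [h0]
    clear h0 he hL
    induction L with
    | nil => simp
    | cons f L ih =>
      rw [List.map_cons, List.prod_cons, natDegree_mul (X_sub_C_ne_zero _), ih,
        natDegree_X_sub_C, List.length_cons, add_comm]
      apply List.prod_ne_zero
      simp [X_sub_C_ne_zero]
  let l : Fin n → ℝ → ℂ := fun j => L.get (Fin.cast hlen j)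
  have hl : ∀ᶠ t in 𝓝 (0 : ℝ), ∀ j, AnalyticAt ℝ (l j) t := by
    rw [Filter.eventually_all]
    intro j
    exact (hL _ (List.get_mem L _)).eventually_analyticAt
  obtain ⟨ε, hε, hball⟩ := Metric.eventually_nhds_iff.mp (hl.and he)
  have hin : ∀ t ∈ Set.Ioo (-ε) ε, dist t 0 < ε := by
    intro t ht
    rw [Real.dist_eq, sub_zero, abs_lt]; exact ht
  refine ⟨γ, hγ, ε, hε, l, fun j t ht => (hball (hin t ht)).1 j, fun t ht => ?_⟩
  refine (hball (hin t ht)).2.trans ?_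
  have : ∏ j : Fin n, (X - C (l j t)) = ∏ j : Fin L.length, (X - C (L.get j t)) :=
    Fintype.prod_equiv (finCongr hlen) _ _ (fun j => rfl)
  rw [this, ← List.prod_ofFn]
  congr 1
  apply List.ext_get <;> simp
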